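/- arXiv:2604.20820 — 3 statements merged into one kernel-verified Lean document; each statement's English description precedes it below -/
import Mathlib

section
/- Let R be a commutative ring with 1, let S be a multiplicatively closed subset of R with 1 ∈ S, and let P be an ideal of R disjoint from S. Then P is an S-prime ideal of R if and only if there exists s ∈ S such that for all ideals I and J of R, I·J ⊆ P implies s·I ⊆ P or s·J ⊆ P (where s·I denotes the set {s·x : x ∈ I}). -/
/-- **Hamed–Malek.** Let `R` be a commutative ring with 1, `S` a multiplicatively
closed subset of `R` with `1 ∈ S`, and `P` an ideal of `R` disjoint from `S`.
Then `P` is an `S`-prime ideal of `R` if and only if there exists `s ∈ S` such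
that for all ideals `I`, `J` of `R`, `I·J ⊆ P` implies `s·I ⊆ P` or `s·J ⊆ P`. -/
theorem sPrime_ideal_iff_ideals {R : Type*} [CommRing R] (S : Set R)
    (h1 : (1 : R) ∈ S) (hS : ∀ s₁ ∈ S, ∀ s₂ ∈ S, s₁ * s₂ ∈ S)
    (P : Ideal R) (hdisj : Disjoint S (P : Set R)) :
    (∃ s ∈ S, ∀ a b : R, a * b ∈ P → s * a ∈ P ∨ s * b ∈ P) ↔
      (∃ s ∈ S, ∀ I J : Ideal R, I * J ≤ P →
        (∀ x ∈ I, s * x ∈ P) ∨ (∀ x ∈ J, s * x ∈ P)) := by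
  refine exists_congr fun s => and_congr_right fun _ => ⟨fun h I J hIJ => ?_, fun h a b hab => ?_⟩
  · by_contra! hcon
    obtain ⟨⟨x, hx, hsx⟩, y, hy, hsy⟩ := hcon
    exact (h x y (hIJ (Ideal.mul_mem_mul hx hy))).elim hsx hsy
  · have hspan : Ideal.span {a} * Ideal.span {b} ≤ P := by
      rwa [Ideal.span_singleton_mul_span_singleton, Ideal.span_singleton_le_iff_mem]
    exact (h _ _ hspan).imp (fun ha => ha a (Ideal.mem_span_singleton_self a))
      (fun hb => hb b (Ideal.mem_span_singleton_self b))
end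

section
/- Let R be a commutative ring with 1 and S a multiplicatively closed subset of R with 1 ∈ S. An ideal P of R is an S-prime ideal of R if and only if both: (i) for every a ∈ S the principal ideal (a) is not contained in P; and (ii) there exists s ∈ S such that for all ideals I, J of R, I·J ⊆ P implies (s)·I ⊆ P or (s)·J ⊆ P, where (s) denotes the principal ideal generated by s. -/
/-- Let `R` be a commutative ring with 1 and `S` a multiplicatively closed subset
of `R` with `1 ∈ S`. An ideal `P` of `R` is an `S`-prime ideal of `R` (i.e. `P` is
disjoint from `S` and there is `s ∈ S` with `ab ∈ P → sa ∈ P ∨ sb ∈ P`) if and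
only if (i) for every `a ∈ S` the principal ideal `(a)` is not contained in `P`,
and (ii) there exists `s ∈ S` such that for all ideals `I`, `J` of `R`,
`I·J ⊆ P` implies `(s)·I ⊆ P` or `(s)·J ⊆ P`. -/
theorem sPrime_ideal_iff_sL_prime_element {R : Type*} [CommRing R] (S : Set R)
    (h1 : (1 : R) ∈ S) (hS : ∀ s₁ ∈ S, ∀ s₂ ∈ S, s₁ * s₂ ∈ S) (P : Ideal R) :
    (Disjoint S (P : Set R) ∧
      ∃ s ∈ S, ∀ a b : R, a * b ∈ P → s * a ∈ P ∨ s * b ∈ P) ↔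
    ((∀ a ∈ S, ¬ Ideal.span {a} ≤ P) ∧
      ∃ s ∈ S, ∀ I J : Ideal R, I * J ≤ P →
        Ideal.span {s} * I ≤ P ∨ Ideal.span {s} * J ≤ P) := by
  simp only [Ideal.span_singleton_le_iff_mem, Ideal.span_singleton_mul_le_iff]
  refine and_congr Set.disjoint_left (exists_congr fun s => and_congr_right fun _ => ?_)
  constructor
  · intro h I J hIJ
    by_contra! ⟨⟨a, ha, hsa⟩, ⟨b, hb, hsb⟩⟩
    exact (h a b (hIJ (Ideal.mul_mem_mul ha hb))).elim hsa hsb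
  · intro h a b hab
    have hle : Ideal.span {a} * Ideal.span {b} ≤ P := by
      rwa [Ideal.span_singleton_mul_span_singleton, Ideal.span_singleton_le_iff_mem]
    exact (h _ _ hle).imp (fun h => h a (Ideal.mem_span_singleton_self a))
      fun h => h b (Ideal.mem_span_singleton_self b)
end

section
/- Let R be a commutative ring with 1 and S a multiplicatively closed subset of R with 1 ∈ S. For all ideals I, A, B of R and every s ∈ S: if (I + (s)·A) ∩ S ≠ ∅ and (I + (s)·B) ∩ S ≠ ∅, then (I + A·B) ∩ S ≠ ∅, where (s) denotes the principal ideal generated by s. In particular (taking s = 1), the family of ideals of R that meet S is an Ako family. -/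
theorem Ideal.add_mul_mul_add_mul_le {R : Type*} [CommRing R] (I J K A B : Ideal R) :
    (I + J * A) * (I + K * B) ≤ I + A * B := by
  rw [add_mul, mul_add, mul_add]
  simp only [Submodule.add_eq_sup]
  refine sup_le (sup_le ?_ ?_) (sup_le ?_ ?_)
  · exact Ideal.mul_le_left.trans le_sup_left
  · exact Ideal.mul_le_left.trans le_sup_left
  · exact Ideal.mul_le_right.trans le_sup_left
  · exact le_sup_of_le_right (Ideal.mul_mono Ideal.mul_le_right Ideal.mul_le_right)

/-- Let `R` be a commutative ring with 1 and `S` a multiplicatively closed subset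
of `R` with `1 ∈ S`. For all ideals `I`, `A`, `B` of `R` and every `s ∈ S`: if
`(I + (s)·A) ∩ S ≠ ∅` and `(I + (s)·B) ∩ S ≠ ∅`, then `(I + A·B) ∩ S ≠ ∅`.
(In particular, taking `s = 1`, the family of ideals of `R` meeting `S` is an
Ako family.) -/
theorem meets_S_is_sAko {R : Type*} [CommRing R] (S : Set R)
    (h1 : (1 : R) ∈ S) (hS : ∀ s₁ ∈ S, ∀ s₂ ∈ S, s₁ * s₂ ∈ S) :
    ∀ (I A B : Ideal R), ∀ s ∈ S,
      (((I + Ideal.span {s} * A : Ideal R) : Set R) ∩ S).Nonempty →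
      (((I + Ideal.span {s} * B : Ideal R) : Set R) ∩ S).Nonempty →
      (((I + A * B : Ideal R) : Set R) ∩ S).Nonempty := by
  rintro I A B s - ⟨x, hx, hxS⟩ ⟨y, hy, hyS⟩
  exact ⟨x * y, Ideal.add_mul_mul_add_mul_le I _ _ A B (Ideal.mul_mem_mul hx hy),
    hS x hxS y hyS⟩
end
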